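/- Let K be a field, n > m >= 1, and let I be the ideal of relations among signed volumes as above. Let phi be an algebra automorphism of the polynomial ring K[A_{i_0...i_m} : 1 <= i_0 < ... < i_m <= n] sending each indeterminate A_{i_0...i_m} to plus-or-minus some indeterminate A_{j_0...j_m} (signs chosen independently). If phi(I) is contained in I, then there exist a permutation pi in S_n and a sign eps in {1,-1} such that phi(A_{i_0...i_m}) = eps * A_{pi(i_0)...pi(i_m)} for all 1 <= i_0 < ... < i_m <= n, where indices on the right are interpreted with the alternating sign convention. -/

import Mathlib

/-- Index type: strictly increasing `(m+1)`-tuples in `{1,…,n}`. -/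
def VolIdx (n m : ℕ) := {s : Fin (m + 1) → Fin n // StrictMono s}

/-- The map sending the indeterminate `A_{i_0 … i_m}` to the generic signed volume
`det (x_{i_j,k} - x_{i_0,k})_{j,k}`. -/
noncomputable def volMap (K : Type*) [Field K] (n m : ℕ) :
    MvPolynomial (VolIdx n m) K →ₐ[K] MvPolynomial (Fin n × Fin m) K :=
  MvPolynomial.aeval fun s =>
    (Matrix.of fun (j k : Fin m) =>
      MvPolynomial.X (s.1 j.succ, k) - MvPolynomial.X (s.1 0, k)).det

namespace Vol18
open Finset

/-- augmented determinant -/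
def D {R : Type*} [CommRing R] {n m : ℕ} (P : Fin n → Fin m → R) (v : Fin (m+1) → Fin n) : R :=
  (Matrix.of fun i j => (Fin.cons 1 (P (v i)) : Fin (m+1) → R) j).det

theorem D_eq {R : Type*} [CommRing R] {n m : ℕ} (P : Fin n → Fin m → R) (v : Fin (m+1) → Fin n) :
    D P v = (Matrix.of fun (j k : Fin m) => P (v j.succ) k - P (v 0) k).det := by
  have h : D P v = (Matrix.of fun (i j : Fin (m+1)) =>
      (Fin.cons (Fin.cons 1 (P (v 0))) (fun (i : Fin m) => Fin.cons 0 (P (v i.succ) - P (v 0))) :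
        Fin (m+1) → Fin (m+1) → R) i j).det := by
    unfold D
    refine Matrix.det_eq_of_forall_row_eq_smul_add_const
      (Fin.cons 0 1) 0 (by simp) ?_
    intro i j
    refine Fin.cases ?_ (fun i => ?_) i
    · simp
    · refine Fin.cases ?_ (fun j => ?_) j <;> simp
  rw [h, Matrix.det_succ_column_zero, Fin.sum_univ_succ]
  simp
  congr 1

theorem D_perm {R : Type*} [CommRing R] {n m : ℕ} (P : Fin n → Fin m → R) (v : Fin (m+1) → Fin n)
    (σ : Equiv.Perm (Fin (m+1))) : D P (v ∘ σ) = ((Equiv.Perm.sign σ : ℤ) : R) * D P v := by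
  unfold D
  rw [← Matrix.det_permute]
  rfl

theorem D_rel {R : Type*} [CommRing R] {n m : ℕ} (P : Fin n → Fin m → R) (w : Fin (m+2) → Fin n) :
    ∑ i : Fin (m+2), (-1 : R)^(i : ℕ) * D P (w ∘ i.succAbove) = 0 := by
  have h : (Matrix.of fun (i j : Fin (m+2)) =>
      (Fin.cons 1 (Fin.cons 1 (P (w i)) : Fin (m+1) → R) : Fin (m+2) → R) j).det = 0 := by
    refine Matrix.det_zero_of_column_eq (i := 0) (j := 1) (by simp) ?_
    intro k
    simp [Fin.cons_one]
  rw [Matrix.det_succ_column_zero] at h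
  rw [← h]
  refine Finset.sum_congr rfl fun i _ => ?_
  simp [D]
  rfl

/-- indicator points -/
def E (K : Type*) [Field K] {n m : ℕ} (F : Fin m → Fin n) : Fin n → Fin m → K :=
  fun x k => if x = F k then 1 else 0

theorem D_E_zero {K : Type*} [Field K] {n m : ℕ} (F : Fin m → Fin n) (v : Fin (m+1) → Fin n)
    (h : ∃ k, ∀ i, v i ≠ F k) : D (E K F) v = 0 := by
  obtain ⟨k, hk⟩ := h
  exact Matrix.det_eq_zero_of_column_eq_zero k.succ (by simp [E, hk])

theorem D_E_ne {K : Type*} [Field K] {n m : ℕ} (F : Fin m → Fin n) (hF : Function.Injective F)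
    (v : Fin (m+1) → Fin n) (hv : Function.Injective v)
    (h : ∀ k, ∃ i, v i = F k) : D (E K F) v ≠ 0 := by
  intro h0
  obtain ⟨u, hu, hM⟩ := Matrix.exists_mulVec_eq_zero_iff.2 h0
  have hrow : ∀ i, u 0 + ∑ k : Fin m, (if v i = F k then u k.succ else 0) = 0 := by
    intro i
    have := congrFun hM i
    simpa [Matrix.mulVec, dotProduct, Fin.sum_univ_succ, E] using this
  have hex : ∃ i, ∀ k, v i ≠ F k := by
    by_contra hc
    push Not at hc
    choose g hg using hc
    have hgi : Function.Injective g := by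
      intro a b hab
      apply hv; rw [hg, hg, hab]
    have := Fintype.card_le_of_injective g hgi
    simp at this
  obtain ⟨i, hi⟩ := hex
  have hu0 : u 0 = 0 := by simpa [hi] using hrow i
  apply hu
  funext j
  refine Fin.cases hu0 (fun k => ?_) j
  obtain ⟨i, hi⟩ := h k
  have := hrow i
  simpa [hi, hF.eq_iff, hu0] using this

theorem comb {α : Type*} [DecidableEq α] {k : ℕ} (hk : 1 ≤ k) (T : Fin (k+1) → Finset α)
    (hT : Function.Injective T) (hc : ∀ i, (T i).card = k)
    (h : ∀ i, ∀ a ∈ T i, ∃ j, j ≠ i ∧ (T i).erase a ⊆ T j) :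
    ∃ J : Finset α, J.card = k + 1 ∧ ∀ i, T i ⊆ J := by
  have key : ∀ i j, T i ⊆ T j → i = j := fun i j hij =>
    hT (Finset.eq_of_subset_of_card_le hij (by rw [hc, hc]))
  choose! g hg0 hg using h 0
  have ginj : Set.InjOn g (T 0) := by
    intro a ha b hb hab
    by_contra hne
    apply hg0 a ha
    symm
    apply key
    intro x hx
    by_cases hxa : x = a
    · rw [hab]; exact hg b hb (Finset.mem_erase.2 ⟨by rw [hxa]; exact hne, hx⟩)
    · exact hg a ha (by simp [hx, hxa])
  have gsurj : ∀ j, j ≠ 0 → ∃ a ∈ T 0, g a = j := by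
    intro j hj
    have : (T 0).image g = Finset.univ.erase 0 := by
      apply Finset.eq_of_subset_of_card_le
      · intro x hx
        obtain ⟨a, ha, rfl⟩ := Finset.mem_image.1 hx
        simp [hg0 a ha]
      · rw [Finset.card_image_of_injOn ginj, hc]; simp
    have hj' : j ∈ (T 0).image g := by rw [this]; simp [hj]
    simpa using hj'
  -- extra points
  have hx : ∀ a ∈ T 0, ∃ x, x ∉ T 0 ∧ T (g a) = insert x ((T 0).erase a) := by
    intro a ha
    have : ((T 0).erase a).card < (T (g a)).card := by
      rw [Finset.card_erase_of_mem ha, hc, hc]; omega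
    obtain ⟨x, hx1, hx2⟩ := Finset.exists_mem_notMem_of_card_lt_card this
    have he : T (g a) = insert x ((T 0).erase a) := by
      symm
      apply Finset.eq_of_subset_of_card_le
      · intro y hy
        rcases Finset.mem_insert.1 hy with rfl | hy
        · exact hx1
        · exact hg a ha hy
      · rw [Finset.card_insert_of_notMem hx2, Finset.card_erase_of_mem ha, hc, hc]; omega
    refine ⟨x, fun hx0 => ?_, he⟩
    have hxa : x = a := by by_contra hne; exact hx2 (by simp [hne, hx0])
    subst hxa
    rw [Finset.insert_erase hx0] at he
    exact hg0 x ha (hT he)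
  choose! x hx0 hx using hx
  have hxx : ∀ a ∈ T 0, ∀ b ∈ T 0, a ≠ b → x a = x b := by
    intro a ha b hb hab
    obtain ⟨j, hj, hsub⟩ := h (g a) b (by rw [hx a ha]; simp [hb, hab.symm])
    have hxaj : x a ∈ T j := hsub (by
      rw [hx a ha]; simp; rintro rfl; exact hx0 a ha hb)
    have hj0 : j ≠ 0 := by rintro rfl; exact hx0 a ha hxaj
    obtain ⟨c, hcT, rfl⟩ := gsurj j hj0
    rw [hx c hcT] at hxaj
    have hxc : x a = x c := by
      rcases Finset.mem_insert.1 hxaj with h1 | h1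
      · exact h1
      · exact absurd (Finset.mem_of_mem_erase h1) (hx0 a ha)
    have hca : c ≠ a := by rintro rfl; exact hj rfl
    by_cases hcb : c = b
    · rw [hxc, hcb]
    · exfalso
      have hm : c ∈ T (g c) := hsub (by rw [hx a ha]; simp [hcb, hca, hcT])
      rw [hx c hcT] at hm
      simp at hm
      exact hx0 c hcT (hm ▸ hcT)
  obtain ⟨a, ha⟩ : (T 0).Nonempty := by rw [← Finset.card_pos, hc]; omega
  refine ⟨insert (x a) (T 0), by rw [Finset.card_insert_of_notMem (hx0 a ha), hc], ?_⟩
  intro i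
  by_cases hi : i = 0
  · subst hi; exact Finset.subset_insert _ _
  · obtain ⟨b, hb, rfl⟩ := gsurj i hi
    rw [hx b hb]
    have : x b = x a := by
      by_cases hab : a = b
      · rw [hab]
      · exact (hxx a ha b hb hab).symm
    rw [this]
    exact Finset.insert_subset_insert _ (Finset.erase_subset _ _)

theorem johnson {n : ℕ} (d : ℕ) : ∀ (k : ℕ), 1 ≤ k → k + 1 + d = n →
    ∀ τ : Finset (Fin n) → Finset (Fin n), (∀ S, S.card = k → (τ S).card = k) →
    (∀ S S', S.card = k → S'.card = k → τ S = τ S' → S = S') →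
    (∀ J : Finset (Fin n), J.card = k + 1 → ∃ J' : Finset (Fin n), J'.card = k + 1 ∧
      ∀ S ⊆ J, S.card = k → τ S ⊆ J') →
    ∃ π : Equiv.Perm (Fin n), ∀ S, S.card = k → τ S = S.map π.toEmbedding := by
  induction d with
  | zero =>
    intro k hk hkn τ hc hi _
    have hcc : ∀ x : Fin n, ({x}ᶜ : Finset (Fin n)).card = k := by
      intro x; rw [Finset.card_compl]; simp; omega
    have : ∀ x : Fin n, ∃ y, τ {x}ᶜ = {y}ᶜ := by
      intro x
      have h1 : (τ {x}ᶜ)ᶜ.card = 1 := by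
        rw [Finset.card_compl, hc _ (hcc x)]; simp; omega
      obtain ⟨y, hy⟩ := Finset.card_eq_one.1 h1
      exact ⟨y, by rw [← hy, compl_compl]⟩
    choose p hp using this
    have pinj : Function.Injective p := by
      intro a b hab
      have := hi _ _ (hcc a) (hcc b) (by rw [hp, hp, hab])
      simpa using this
    refine ⟨Equiv.ofBijective p (Finite.injective_iff_bijective.1 pinj), ?_⟩
    intro S hS
    have h1 : Sᶜ.card = 1 := by rw [Finset.card_compl, hS]; simp; omega
    obtain ⟨y, hy⟩ := Finset.card_eq_one.1 h1
    have hSy : S = {y}ᶜ := by rw [← hy, compl_compl]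
    subst hSy
    rw [hp]
    symm
    apply Finset.eq_of_subset_of_card_le
    · intro z hz
      simp at hz ⊢
      rintro rfl
      apply hz
      rw [Equiv.symm_apply_eq]
      rfl
    · simp [Finset.card_compl]
  | succ d ih =>
    intro k hk hkn τ hc hi hJ
    choose! τ' hc' hsub using hJ
    have hi' : ∀ S S', S.card = k+1 → S'.card = k+1 → τ' S = τ' S' → S = S' := by
      intro J1 J2 h1 h2 h12
      by_contra hne
      -- all k-subsets of J1 and of J2 map into k-subsets of τ' J1
      have hle : ((J1.powersetCard k) ∪ (J2.powersetCard k)).card ≤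
          ((τ' J1).powersetCard k).card := by
        apply Finset.card_le_card_of_injOn τ
        · intro S hS
          simp only [Finset.coe_union, Set.mem_union, Finset.mem_coe, Finset.mem_powersetCard] at hS ⊢
          rcases hS with ⟨hS, hSk⟩ | ⟨hS, hSk⟩
          · exact ⟨hsub J1 h1 S hS hSk, hc S hSk⟩
          · exact ⟨h12 ▸ hsub J2 h2 S hS hSk, hc S hSk⟩
        · intro S hS S' hS'
          simp only [Finset.coe_union, Set.mem_union, Finset.mem_coe, Finset.mem_powersetCard] at hS hS'
          exact hi S S' (by tauto) (by tauto)
      rw [Finset.card_powersetCard, hc' _ h1] at hle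
      have heq : J1.powersetCard k = J1.powersetCard k ∪ J2.powersetCard k :=
        Finset.eq_of_subset_of_card_le Finset.subset_union_left
          (by rw [Finset.card_powersetCard, h1]; exact hle)
      apply hne
      symm
      apply Finset.eq_of_subset_of_card_le _ (by omega)
      intro y hy
      obtain ⟨z, hz, hzy⟩ : ∃ z ∈ J2, z ≠ y :=
        Finset.exists_mem_ne (by omega) y
      have : J2.erase z ∈ J1.powersetCard k := by
        rw [heq]
        simp [Finset.mem_powersetCard, Finset.erase_subset, Finset.card_erase_of_mem hz, h2]
      exact (Finset.mem_powersetCard.1 this).1 (by simp [hy, hzy.symm])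
    have hJ' : ∀ M : Finset (Fin n), M.card = k + 1 + 1 → ∃ M' : Finset (Fin n),
        M'.card = k + 1 + 1 ∧ ∀ S ⊆ M, S.card = k + 1 → τ' S ⊆ M' := by
      intro M hM
      obtain ⟨a, ha, b, hb, hab⟩ := Finset.one_lt_card.1 (show 1 < M.card by omega)
      have ce : ∀ y ∈ M, (M.erase y).card = k + 1 := fun y hy => by
        rw [Finset.card_erase_of_mem hy, hM]; rfl
      have ce2 : ∀ y ∈ M, ∀ z ∈ M, y ≠ z → ((M.erase y).erase z).card = k := fun y hy z hz hyz => by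
        rw [Finset.card_erase_of_mem (by simp [hz, hyz.symm]), ce y hy]; rfl
      have sub1 : ∀ y ∈ M, ∀ z ∈ M, y ≠ z → τ ((M.erase y).erase z) ⊆ τ' (M.erase y) :=
        fun y hy z hz hyz => hsub _ (ce y hy) _ (Finset.erase_subset _ _) (ce2 y hy z hz hyz)
      have sub2 : ∀ y ∈ M, ∀ z ∈ M, y ≠ z → τ ((M.erase y).erase z) ⊆ τ' (M.erase z) :=
        fun y hy z hz hyz => by
          rw [Finset.erase_right_comm]; exact sub1 z hz y hy hyz.symm
      have cardU : ∀ (A B : Finset (Fin n)) (k : ℕ), A.card = k → B.card = k → A ≠ B →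
          k + 1 ≤ (A ∪ B).card := by
        intro A B k hA hB hAB
        by_contra hlt
        have e1 : A = A ∪ B := Finset.eq_of_subset_of_card_le Finset.subset_union_left (by omega)
        have e2 : B = A ∪ B := Finset.eq_of_subset_of_card_le Finset.subset_union_right (by omega)
        exact hAB (e1.trans e2.symm)
      refine ⟨τ' (M.erase a) ∪ τ' (M.erase b), le_antisymm ?_ ?_, ?_⟩
      · have h1 := Finset.card_union_add_card_inter (τ' (M.erase a)) (τ' (M.erase b))
        have h2 := Finset.card_le_card (Finset.subset_inter (sub1 a ha b hb hab) (sub2 a ha b hb hab))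
        rw [hc _ (ce2 a ha b hb hab)] at h2
        rw [hc' _ (ce a ha), hc' _ (ce b hb)] at h1
        omega
      · apply cardU _ _ _ (hc' _ (ce a ha)) (hc' _ (ce b hb))
        intro h
        have := hi' _ _ (ce a ha) (ce b hb) h
        have hbm : b ∈ M.erase a := by simp [hb, hab.symm]
        rw [this] at hbm
        simp at hbm
      · intro S hS hSc
        have : (M \ S).card = 1 := by rw [Finset.card_sdiff_of_subset hS]; omega
        obtain ⟨c, hcS⟩ := Finset.card_eq_one.1 this
        have hcM : c ∈ M := by
          have : c ∈ M \ S := by rw [hcS]; simp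
          exact (Finset.mem_sdiff.1 this).1
        have hSe : S = M.erase c := by
          rw [Finset.erase_eq, ← hcS, Finset.sdiff_sdiff_eq_self hS]
        subst hSe
        by_cases hca : c = a
        · subst hca; exact Finset.subset_union_left
        by_cases hcb : c = b
        · subst hcb; exact Finset.subset_union_right
        have hU : τ ((M.erase a).erase c) ∪ τ ((M.erase b).erase c) = τ' (M.erase c) := by
          apply Finset.eq_of_subset_of_card_le
          · exact Finset.union_subset (sub2 a ha c hcM (Ne.symm hca)) (sub2 b hb c hcM (Ne.symm hcb))
          · rw [hc' _ (ce c hcM)]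
            apply cardU _ _ _ (hc _ (ce2 a ha c hcM (Ne.symm hca))) (hc _ (ce2 b hb c hcM (Ne.symm hcb)))
            intro h
            have := hi _ _ (ce2 a ha c hcM (Ne.symm hca)) (ce2 b hb c hcM (Ne.symm hcb)) h
            have hbm : b ∈ (M.erase a).erase c := by simp [hb, hab.symm, Ne.symm hcb]
            rw [this] at hbm
            simp at hbm
        rw [← hU]
        exact Finset.union_subset_union (sub1 a ha c hcM (Ne.symm hca)) (sub1 b hb c hcM (Ne.symm hcb))
    obtain ⟨π, hπ⟩ := ih (k+1) (by omega) (by omega) τ' hc' hi' hJ'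
    refine ⟨π, fun S hS => ?_⟩
    have hcard : 1 < Sᶜ.card := by rw [Finset.card_compl, hS]; simp; omega
    obtain ⟨a, ha, b, hb, hab⟩ := Finset.one_lt_card.1 hcard
    rw [Finset.mem_compl] at ha hb
    apply Finset.eq_of_subset_of_card_le _ (by rw [Finset.card_map, hS, hc S hS])
    intro y hy
    have step : ∀ c ∉ S, y ∈ (insert c S).map π.toEmbedding := by
      intro c hcS
      have hcc : (insert c S).card = k + 1 := by rw [Finset.card_insert_of_notMem hcS, hS]
      rw [← hπ _ hcc]
      exact hsub _ hcc S (Finset.subset_insert _ _) hS hy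
    have h1 := step a ha
    have h2 := step b hb
    simp only [Finset.mem_map_equiv, Finset.mem_insert] at h1 h2 ⊢
    rcases h1 with h1 | h1
    · rcases h2 with h2 | h2
      · exact absurd (h1.symm.trans h2) hab
      · exact h2
    · exact h1

theorem conn {α K : Type*} [DecidableEq α] {k : ℕ} (c : Finset α → K)
    (h : ∀ J : Finset α, J.card = k + 1 → ∀ S ⊆ J, ∀ S' ⊆ J, S.card = k → S'.card = k → c S = c S') :
    ∀ (d : ℕ) (S S' : Finset α), S.card = k → S'.card = k → (S \ S').card = d → c S = c S' := by
  intro d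
  induction d with
  | zero =>
    intro S S' hS hS' h0
    rw [Finset.card_eq_zero, Finset.sdiff_eq_empty_iff_subset] at h0
    rw [Finset.eq_of_subset_of_card_le h0 (by omega)]
  | succ d ih =>
    intro S S' hS hS' hd
    obtain ⟨a, ha⟩ : (S \ S').Nonempty := by rw [← Finset.card_pos]; omega
    have hd' : (S' \ S).card = d + 1 := by
      rw [← hd]; exact Finset.card_sdiff_comm (by omega)
    obtain ⟨b, hb⟩ : (S' \ S).Nonempty := by rw [← Finset.card_pos]; omega
    rw [Finset.mem_sdiff] at ha hb
    have hcard : (insert b (S.erase a)).card = k := by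
      rw [Finset.card_insert_of_notMem (by simp [hb.2]), Finset.card_erase_of_mem ha.1]
      have := Finset.card_pos.2 ⟨a, ha.1⟩
      omega
    rw [h (insert b S) (by rw [Finset.card_insert_of_notMem hb.2, hS]) S (Finset.subset_insert _ _)
      (insert b (S.erase a)) (Finset.insert_subset_insert _ (Finset.erase_subset _ _)) hS hcard]
    apply ih _ _ hcard hS'
    have : insert b (S.erase a) \ S' = (S \ S').erase a := by
      ext y
      simp only [Finset.mem_sdiff, Finset.mem_insert, Finset.mem_erase]
      constructor
      · rintro ⟨rfl | h1, h2⟩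
        · exact absurd hb.1 h2
        · exact ⟨h1.1, h1.2, h2⟩
      · rintro ⟨h1, h2, h3⟩
        exact ⟨Or.inr ⟨h1, h2⟩, h3⟩
    rw [this, Finset.card_erase_of_mem (by simp [ha]), hd]
    rfl


theorem DF (K : Type*) [Field K] {n m : ℕ} (F : Finset (Fin n)) (hF : F.card = m) :
    ∃ P : Fin n → Fin m → K, ∀ v : Fin (m+1) → Fin n, Function.Injective v →
      (D P v ≠ 0 ↔ F ⊆ Finset.univ.image v) := by
  refine ⟨E K (F.orderEmbOfFin hF), fun v hv => ⟨fun h => ?_, fun h => ?_⟩⟩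
  · by_contra hn
    rw [Finset.not_subset] at hn
    obtain ⟨x, hx, hxv⟩ := hn
    apply h
    apply D_E_zero
    have hx' : x ∈ Set.range (F.orderEmbOfFin hF) := by
      rw [Finset.range_orderEmbOfFin]; exact hx
    obtain ⟨k, rfl⟩ := hx'
    refine ⟨k, fun i hi => hxv ?_⟩
    rw [← hi]; simp
  · apply D_E_ne _ (F.orderEmbOfFin hF).injective _ hv
    intro k
    have := h (Finset.orderEmbOfFin_mem F hF k)
    simpa using this

/-- underlying set -/
def toS {n m : ℕ} (s : VolIdx n m) : Finset (Fin n) := Finset.univ.image s.1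

theorem toS_card {n m : ℕ} (s : VolIdx n m) : (toS s).card = m + 1 := by
  rw [toS, Finset.card_image_of_injective _ s.2.injective]; simp

theorem toS_inj {n m : ℕ} {s t : VolIdx n m} (h : toS s = toS t) : s = t := by
  apply Subtype.ext
  apply (StrictMono.range_inj s.2 t.2).1
  have := congrArg (fun S : Finset (Fin n) => (S : Set (Fin n))) h
  simpa [toS] using this

theorem toS_surj {n m : ℕ} (S : Finset (Fin n)) (h : S.card = m + 1) :
    ∃ s : VolIdx n m, toS s = S := by
  refine ⟨⟨S.orderEmbOfFin h, (S.orderEmbOfFin h).strictMono⟩, ?_⟩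
  simp [toS]

/-- faces -/
def face {n m : ℕ} (w : Fin (m+2) → Fin n) (hw : StrictMono w) (i : Fin (m+2)) : VolIdx n m :=
  ⟨w ∘ i.succAbove, hw.comp (Fin.strictMono_succAbove i)⟩

theorem toS_face {n m : ℕ} (w : Fin (m+2) → Fin n) (hw : StrictMono w) (i : Fin (m+2)) :
    toS (face w hw i) = (Finset.univ.image w).erase (w i) := by
  ext x
  simp only [toS, face, Finset.mem_image, Finset.mem_univ, true_and, Finset.mem_erase,
    Function.comp]
  constructor
  · rintro ⟨a, rfl⟩
    exact ⟨fun h => Fin.succAbove_ne i a (hw.injective h), _, rfl⟩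
  · rintro ⟨h, a, rfl⟩
    obtain ⟨b, hb⟩ := Fin.exists_succAbove_eq (x := a) (y := i) (by rintro rfl; exact h rfl)
    exact ⟨b, by rw [hb]⟩

theorem exists_face {n m : ℕ} (J : Finset (Fin n)) (hJ : J.card = m + 2) :
    ∃ (w : Fin (m+2) → Fin n) (hw : StrictMono w), Finset.univ.image w = J ∧
      ∀ s : VolIdx n m, toS s ⊆ J → ∃ i, s = face w hw i := by
  refine ⟨J.orderEmbOfFin hJ, (J.orderEmbOfFin hJ).strictMono, by simp, ?_⟩
  intro s hs
  have h1 : (J \ toS s).card = 1 := by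
    rw [Finset.card_sdiff_of_subset hs, toS_card]; omega
  obtain ⟨y, hy⟩ := Finset.card_eq_one.1 h1
  have hyJ : y ∈ J := by
    have : y ∈ J \ toS s := by rw [hy]; simp
    exact (Finset.mem_sdiff.1 this).1
  have hy' : y ∈ Set.range (J.orderEmbOfFin hJ) := by
    rw [Finset.range_orderEmbOfFin]; exact hyJ
  obtain ⟨i, rfl⟩ := hy'
  refine ⟨i, toS_inj ?_⟩
  rw [toS_face, Finset.image_orderEmbOfFin_univ, Finset.erase_eq, ← hy,
    Finset.sdiff_sdiff_eq_self hs]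

theorem volMap_X {K : Type*} [Field K] {n m : ℕ} (s : VolIdx n m) :
    volMap K n m (MvPolynomial.X s) =
      D (fun x k => (MvPolynomial.X (x, k) : MvPolynomial (Fin n × Fin m) K)) s.1 := by
  rw [D_eq, volMap, MvPolynomial.aeval_X]

theorem eval_D {K : Type*} [Field K] {n m : ℕ} (P : Fin n → Fin m → K) (v : Fin (m+1) → Fin n) :
    MvPolynomial.eval (fun x : Fin n × Fin m => P x.1 x.2)
      (D (fun x k => (MvPolynomial.X (x, k) : MvPolynomial (Fin n × Fin m) K)) v) = D P v := by
  rw [D_eq, D_eq, RingHom.map_det]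
  congr 1
  ext i j
  simp

end Vol18

open Vol18 in
theorem stmt18 {K : Type*} [Field K] {m n : ℕ} (hm : 1 ≤ m) (hmn : m < n)
    (I : Ideal (MvPolynomial (VolIdx n m) K))
    (hI : I = RingHom.ker (volMap K n m).toRingHom)
    (φ : MvPolynomial (VolIdx n m) K ≃ₐ[K] MvPolynomial (VolIdx n m) K)
    (hmono : ∀ s : VolIdx n m, ∃ (t : VolIdx n m) (ε : K), (ε = 1 ∨ ε = -1) ∧
      φ (MvPolynomial.X s) = ε • MvPolynomial.X t)
    (hφI : ∀ p ∈ I, φ p ∈ I) :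
    ∃ (π : Equiv.Perm (Fin n)) (ε : K), (ε = 1 ∨ ε = -1) ∧
      ∀ s : VolIdx n m, ∃ (t : VolIdx n m) (σ : Equiv.Perm (Fin (m + 1))),
        π ∘ s.1 = t.1 ∘ σ ∧
        φ (MvPolynomial.X s) =
          (ε * ((Equiv.Perm.sign σ : ℤ) : K)) • MvPolynomial.X t := by
  have hmem : ∀ p, p ∈ I ↔ volMap K n m p = 0 := by
    intro p; rw [hI, RingHom.mem_ker]; rfl
  choose T ε hε hφ using hmono
  have hε0 : ∀ s, ε s ≠ 0 := by
    intro s; rcases hε s with h | h <;> simp [h]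
  have Tinj : Function.Injective T := by
    intro s s' h
    have h1 : φ (ε s' • MvPolynomial.X s) = φ (ε s • MvPolynomial.X s') := by
      rw [map_smul, map_smul, hφ, hφ, h, smul_comm]
    have h2 := φ.injective h1
    by_contra hne
    have h3 := congrArg (MvPolynomial.coeff (Finsupp.single s 1)) h2
    classical
    simp [MvPolynomial.coeff_X, Finsupp.single_left_inj, Ne.symm hne, hε0] at h3
  have rel : ∀ (w : Fin (m+2) → Fin n) (hw : StrictMono w) (P : Fin n → Fin m → K),
      ∑ i : Fin (m+2), (-1 : K)^(i : ℕ) * (ε (face w hw i) * D P (T (face w hw i)).1) = 0 := by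
    intro w hw P
    have h1 : (∑ i : Fin (m+2), ((-1 : K)^(i : ℕ)) • MvPolynomial.X (face w hw i)) ∈ I := by
      rw [hmem, map_sum, ← D_rel (fun x k => (MvPolynomial.X (x, k) : MvPolynomial (Fin n × Fin m) K)) w]
      · refine Finset.sum_congr rfl fun i _ => ?_
        rw [map_smul, volMap_X, MvPolynomial.smul_eq_C_mul]
        simp [face]
    have h2 := (hmem _).1 (hφI _ h1)
    have h3 := congrArg (MvPolynomial.eval (fun x : Fin n × Fin m => P x.1 x.2)) h2
    rw [map_sum, map_sum, map_sum, map_zero] at h3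
    rw [← h3]
    refine Finset.sum_congr rfl fun i _ => ?_
    rw [map_smul, hφ, map_smul (volMap K n m), map_smul (volMap K n m), volMap_X,
      MvPolynomial.smul_eval, MvPolynomial.smul_eval, eval_D]
  obtain ⟨s0⟩ : Nonempty (VolIdx n m) := by
    obtain ⟨S, -, hS⟩ := Finset.exists_subset_card_eq (s := (Finset.univ : Finset (Fin n)))
      (n := m+1) (by simp; omega)
    exact ⟨(toS_surj S hS).choose⟩
  haveI : Nonempty (VolIdx n m) := ⟨s0⟩
  have hsurj := toS_surj (n := n) (m := m)
  choose! o ho using hsurj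
  have hos : ∀ s, o (toS s) = s := fun s => toS_inj (ho _ (toS_card s))
  -- the combinatorial part
  have hJ : ∀ J : Finset (Fin n), J.card = m + 1 + 1 → ∃ J' : Finset (Fin n), J'.card = m + 1 + 1 ∧
      ∀ S ⊆ J, S.card = m + 1 → toS (T (o S)) ⊆ J' := by
    intro J hJ
    obtain ⟨w, hw, hwJ, hface⟩ := exists_face J hJ
    have finj : Function.Injective (face w hw) := by
      intro i j hij
      by_contra hne
      have := congrArg toS hij
      rw [toS_face, toS_face] at this
      have h1 : w j ∈ (Finset.univ.image w).erase (w i) := by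
        simp [hw.injective.eq_iff, Ne.symm hne]
      rw [this] at h1
      simp at h1
    obtain ⟨J', hJ', hsub⟩ := comb (k := m+1) (by omega) (fun i => toS (T (face w hw i)))
      (fun i j h => finj (Tinj (toS_inj h))) (fun i => toS_card _) (by
        intro i a ha
        by_contra hn
        push Not at hn
        obtain ⟨P, hP⟩ := DF K ((toS (T (face w hw i))).erase a)
          (by rw [Finset.card_erase_of_mem ha, toS_card, Nat.add_sub_cancel])
        have hr := rel w hw P
        rw [Finset.sum_eq_single i] at hr
        · have : D P (T (face w hw i)).1 ≠ 0 :=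
            (hP _ (T (face w hw i)).2.injective).2 (Finset.erase_subset _ _)
          simp [hε0, this] at hr
        · intro j _ hj
          have : D P (T (face w hw j)).1 = 0 := by
            by_contra h0
            exact hn j hj ((hP _ (T (face w hw j)).2.injective).1 h0)
          simp [this]
        · simp)
    refine ⟨J', hJ', fun S hS hSc => ?_⟩
    obtain ⟨i, hi⟩ := hface (o S) (by rw [ho S hSc]; exact hS)
    rw [hi]
    exact hsub i
  have hπ : ∃ π : Equiv.Perm (Fin n), ∀ S : Finset (Fin n), S.card = m + 1 →
      toS (T (o S)) = S.map π.toEmbedding := by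
    by_cases hn : n = m + 1
    · refine ⟨1, fun S hS => ?_⟩
      have h1 : ∀ S : Finset (Fin n), S.card = m + 1 → S = Finset.univ := fun S hS => by
        rw [← Finset.card_eq_iff_eq_univ, hS]; simp [hn]
      rw [h1 (toS _) (toS_card _), h1 (S.map _) (by rw [Finset.card_map, hS])]
    · obtain ⟨d, hd⟩ := Nat.exists_eq_add_of_le (show m + 1 + 1 ≤ n by omega)
      refine johnson d (m+1) (by omega) hd.symm (fun S => toS (T (o S))) (fun S _ => toS_card _)
        ?_ hJ
      intro S S' hS hS' h
      have := Tinj (toS_inj h)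
      rw [← ho S hS, ← ho S' hS', this]
  obtain ⟨π, hπ⟩ := hπ
  have hπ' : ∀ s, toS (T s) = (toS s).map π.toEmbedding := fun s => by
    rw [← hπ _ (toS_card s), hos]
  have hσ : ∀ s, ∃ σ : Equiv.Perm (Fin (m+1)), π ∘ s.1 = (T s).1 ∘ σ := by
    intro s
    have : ∀ i, ∃ j, (T s).1 j = π (s.1 i) := by
      intro i
      have : π (s.1 i) ∈ toS (T s) := by
        rw [hπ']; simp [toS]
      simpa [toS] using this
    choose g hg using this
    have ginj : Function.Injective g := by
      intro a b hab
      apply s.2.injective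
      apply π.injective
      rw [← hg, ← hg, hab]
    exact ⟨Equiv.ofBijective g (Finite.injective_iff_bijective.1 ginj), by
      funext i; simp [hg]⟩
  choose σ hσ using hσ
  have sgn : ∀ s, (((Equiv.Perm.sign (σ s) : ℤ) : K)) * ((Equiv.Perm.sign (σ s) : ℤ) : K) = 1 := by
    intro s
    rcases Int.units_eq_one_or (Equiv.Perm.sign (σ s)) with h | h <;> simp [h]
  have hD : ∀ s (P : Fin n → Fin m → K),
      D P (T s).1 = ((Equiv.Perm.sign (σ s) : ℤ) : K) * D P (π ∘ s.1) := by
    intro s P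
    rw [hσ, D_perm, ← mul_assoc, sgn, one_mul]
  let c : VolIdx n m → K := fun s => ε s * ((Equiv.Perm.sign (σ s) : ℤ) : K)
  have hc : ∀ s s', c s = c s' := by
    intro s s'
    have := conn (k := m+1) (fun S => c (o S)) ?_ _ (toS s) (toS s') (toS_card _) (toS_card _) rfl
    · simpa only [hos] using this
    intro J hJ S hS S' hS' hSc hSc'
    obtain ⟨w, hw, hwJ, hface⟩ := exists_face J hJ
    obtain ⟨i, hi⟩ := hface (o S) (by rw [ho S hSc]; exact hS)
    obtain ⟨j, hj⟩ := hface (o S') (by rw [ho S' hSc']; exact hS')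
    show c (o S) = c (o S')
    rw [hi, hj]
    by_cases hij : i = j
    · rw [hij]
    have hwi : ∀ l, w l ∈ J := fun l => by rw [← hwJ]; simp
    obtain ⟨P, hP⟩ := DF K (m := m) (((J.erase (w i)).erase (w j)).map π.toEmbedding) (by
      rw [Finset.card_map, Finset.card_erase_of_mem (by simp [hwi, hw.injective.eq_iff, Ne.symm hij]),
        Finset.card_erase_of_mem (hwi i), hJ]; rfl)
    have himg : ∀ l, Finset.univ.image (π ∘ (face w hw l).1) = (J.erase (w l)).map π.toEmbedding := by
      intro l
      rw [← hwJ, ← toS_face w hw, toS, Finset.map_eq_image, Finset.image_image]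
      rfl
    have h1 := rel w hw P
    have h2 := D_rel P (π ∘ w)
    have h3 : ∑ l : Fin (m+2), (-1 : K)^(l : ℕ) * ((c (face w hw l) - c (face w hw j)) *
        D P (π ∘ (face w hw l).1)) = 0 := by
      have : ∑ l : Fin (m+2), (-1 : K)^(l : ℕ) * ((c (face w hw l) - c (face w hw j)) *
        D P (π ∘ (face w hw l).1)) = 0 - c (face w hw j) * 0 := by
        nth_rewrite 1 [← h1]
        rw [← h2, Finset.mul_sum, ← Finset.sum_sub_distrib]
        refine Finset.sum_congr rfl fun l _ => ?_
        rw [hD]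
        simp only [c, face, Function.comp_assoc]
        ring
      simpa using this
    have hinj : ∀ l, Function.Injective (π ∘ (face w hw l).1) := fun l =>
      π.injective.comp (face w hw l).2.injective
    rw [Finset.sum_eq_single i] at h3
    · have : D P (π ∘ (face w hw i).1) ≠ 0 := by
        rw [hP _ (hinj i), himg]
        exact Finset.map_subset_map.2 (Finset.erase_subset _ _)
      simpa [this, sub_eq_zero] using h3
    · intro l _ hl
      by_cases hlj : l = j
      · simp [hlj]
      have : D P (π ∘ (face w hw l).1) = 0 := by
        by_contra h0
        have h4 := (hP _ (hinj l)).1 h0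
        rw [himg, Finset.map_subset_map] at h4
        have h5 : w l ∈ (J.erase (w i)).erase (w j) := by
          simp [hwi, hw.injective.eq_iff, hl, hlj]
        simpa using h4 h5
      simp [this]
    · simp
  refine ⟨π, c s0, ?_, fun s => ⟨T s, σ s, hσ s, ?_⟩⟩
  · rcases Int.units_eq_one_or (Equiv.Perm.sign (σ s0)) with h | h <;>
      rcases hε s0 with h' | h' <;> simp [c, h, h']
  · rw [hφ, hc s0 s]
    simp only [c]
    rw [mul_assoc, sgn, mul_one]
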